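/- Assume at least one of S, S⁻¹ is bounded and that ρ(S) > 1/ρ(S⁻¹). Let M be a multiplier on E. Then for every z in the open annulus A = { z ∈ ℂ : 1/ρ(S⁻¹) < |z| < ρ(S) } (the interior of spec(S); here 1/ρ(S⁻¹) = 0 if ρ(S⁻¹) = +∞, and the upper constraint is vacuous if ρ(S) = +∞) the Laurent series M̃(z) = Σ_{n∈ℤ} M̂(n) zⁿ converges, and the resulting function M̃ is holomorphic on A and satisfies |M̃(z)| ≤ ‖M‖ for all z ∈ A. -/

import Mathlib

open scoped ENNReal

/-- The spectrum of a (possibly unbounded, partially defined) linear operator on a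
Banach space. -/
def pSpec {E : Type*} [NormedAddCommGroup E] [NormedSpace ℂ E]
    (A : E →ₗ.[ℂ] E) : Set ℂ :=
  {lam | ¬ Function.Bijective fun x : A.domain => A x - lam • (x : E)}

/-- The spectral radius (in `ℝ≥0∞`) of a possibly unbounded operator. -/
noncomputable def pRad {E : Type*} [NormedAddCommGroup E] [NormedSpace ℂ E]
    (A : E →ₗ.[ℂ] E) : ℝ≥0∞ :=
  ⨆ lam ∈ pSpec A, (‖lam‖₊ : ℝ≥0∞)

/-- Operators that agree on the basis vectors agree. -/
theorem aux_ext {E : Type*} [NormedAddCommGroup E] [NormedSpace ℂ E]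
    (e : ℤ → E) (hdense : Dense (Submodule.span ℂ (Set.range e) : Set E))
    (A B : E →L[ℂ] E) (h : ∀ k, A (e k) = B (e k)) : A = B := by
  refine ContinuousLinearMap.ext_on hdense ?_
  rintro _ ⟨k, rfl⟩
  exact h k

/-- The everywhere defined shift is a bounded operator. -/
theorem aux_shift {E : Type*} [NormedAddCommGroup E] [NormedSpace ℂ E] [CompleteSpace E]
    (ι : E →ₗ[ℂ] (ℤ → ℂ)) (hι : Function.Injective ι)
    (hcoord : ∀ n : ℤ, Continuous fun x : E => ι x n)
    (hb : ∀ x : E, ∃ y : E, ∀ n : ℤ, ι y n = ι x (n - 1)) :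
    ∃ S : E →L[ℂ] E, ∀ x n, ι (S x) n = ι x (n - 1) := by
  choose s hs using hb
  let L : E →ₗ[ℂ] E :=
    { toFun := s
      map_add' := fun x y => hι (by ext n; simp [hs])
      map_smul' := fun c x => hι (by ext n; simp [hs]) }
  have hL : ∀ x n, ι (L x) n = ι x (n - 1) := hs
  refine ⟨⟨L, L.continuous_of_seq_closed_graph ?_⟩, hL⟩
  intro u x y hu hy
  apply hι
  ext n
  rw [hL]
  have h1 := ((hcoord n).tendsto y).comp hy
  have h2 := ((hcoord (n - 1)).tendsto x).comp hu
  refine tendsto_nhds_unique h1 (h2.congr fun m => ?_)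
  exact (hL (u m) n).symm

/-- The rotation operators as bounded operators. -/
theorem aux_rot {E : Type*} [NormedAddCommGroup E] [NormedSpace ℂ E]
    (ι : E →ₗ[ℂ] (ℤ → ℂ)) (hι : Function.Injective ι) (Ψ : ℂ → E → E)
    (hΨ : ∀ z : ℂ, ‖z‖ = 1 → ∀ x : E, ∀ n : ℤ, ι (Ψ z x) n = ι x n * z ^ n)
    (hΨiso : ∀ z : ℂ, ‖z‖ = 1 → ∀ x : E, ‖Ψ z x‖ = ‖x‖) (w : ℂ) (hw : ‖w‖ = 1) :
    ∃ U : E →L[ℂ] E, (∀ x, U x = Ψ w x) := by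
  let L : E →ₗ[ℂ] E :=
    { toFun := Ψ w
      map_add' := fun x y => hι (by ext n; simp [hΨ w hw, add_mul])
      map_smul' := fun c x => hι (by ext n; simp [hΨ w hw, mul_assoc]) }
  exact ⟨L.mkContinuous 1 (fun x => by simp [L, hΨiso w hw]), fun x => rfl⟩

/-- Rotation of the resolvent. -/
theorem aux_rot_res {E : Type*} [NormedAddCommGroup E] [NormedSpace ℂ E] [CompleteSpace E]
    (ι : E →ₗ[ℂ] (ℤ → ℂ)) (hι : Function.Injective ι)
    (e : ℤ → E) (he : ∀ k : ℤ, ι (e k) = Pi.single k 1)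
    (Ψ : ℂ → E → E)
    (hΨ : ∀ z : ℂ, ‖z‖ = 1 → ∀ x : E, ∀ n : ℤ, ι (Ψ z x) n = ι x n * z ^ n)
    (hΨiso : ∀ z : ℂ, ‖z‖ = 1 → ∀ x : E, ‖Ψ z x‖ = ‖x‖)
    (S : E →L[ℂ] E) (hS : ∀ x n, ι (S x) n = ι x (n - 1))
    (z w : ℂ) (hw : ‖w‖ = 1) (hz : z ∈ resolventSet ℂ S) :
    w * z ∈ resolventSet ℂ S ∧
      ∀ n, ι (resolvent S (w * z) (e 0)) n = w ^ (-n - 1) * ι (resolvent S z (e 0)) n := by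
  have hw0 : w ≠ 0 := by rintro rfl; simp at hw
  have hwi : ‖w⁻¹‖ = 1 := by simp [hw]
  obtain ⟨U, hU⟩ := aux_rot ι hι Ψ hΨ hΨiso w hw
  obtain ⟨V, hV⟩ := aux_rot ι hι Ψ hΨ hΨiso w⁻¹ hwi
  have hU' : ∀ x n, ι (U x) n = ι x n * w ^ n := fun x n => by rw [hU, hΨ w hw]
  have hV' : ∀ x n, ι (V x) n = ι x n * w⁻¹ ^ n := fun x n => by rw [hV, hΨ _ hwi]
  have hUV : U * V = 1 := by
    ext x; apply hι; ext n
    have hwn : w ^ n ≠ 0 := zpow_ne_zero _ hw0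
    simp [hU', hV', hwn]
  have hVU : V * U = 1 := by
    ext x; apply hι; ext n
    have hwn : w ^ n ≠ 0 := zpow_ne_zero _ hw0
    simp [hU', hV', hwn]
  have hSc : S = w • (V * S * U) := by
    ext x; apply hι; ext n
    simp [hU', hV', hS, zpow_sub_one₀ hw0]
    field_simp
  have hR1 : (algebraMap ℂ (E →L[ℂ] E) z - S) * resolvent S z = 1 := by
    exact Ring.mul_inverse_cancel _ hz
  have hR2 : resolvent S z * (algebraMap ℂ (E →L[ℂ] E) z - S) = 1 := by
    exact Ring.inverse_mul_cancel _ hz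
  have key : algebraMap ℂ (E →L[ℂ] E) (w * z) - S
      = w • (V * (algebraMap ℂ (E →L[ℂ] E) z - S) * U) := by
    conv_lhs => rw [hSc]
    rw [mul_sub, sub_mul, smul_sub]
    congr 1
    rw [Algebra.algebraMap_eq_smul_one, Algebra.algebraMap_eq_smul_one]
    rw [mul_smul_comm, smul_mul_assoc, mul_one, hVU, smul_smul]
  have k1 : (algebraMap ℂ (E →L[ℂ] E) (w * z) - S) * (w⁻¹ • (V * resolvent S z * U)) = 1 := by
    rw [key, smul_mul_smul_comm, mul_inv_cancel₀ hw0, one_smul]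
    calc _ = V * (algebraMap ℂ (E →L[ℂ] E) z - S) * (U * V) * resolvent S z * U := by
          simp only [mul_assoc]
      _ = 1 := by rw [hUV, mul_one, mul_assoc V, hR1, mul_one, hVU]
  have k2 : (w⁻¹ • (V * resolvent S z * U)) * (algebraMap ℂ (E →L[ℂ] E) (w * z) - S) = 1 := by
    rw [key, smul_mul_smul_comm, inv_mul_cancel₀ hw0, one_smul]
    calc _ = V * resolvent S z * (U * V) * (algebraMap ℂ (E →L[ℂ] E) z - S) * U := by
          simp only [mul_assoc]
      _ = 1 := by rw [hUV, mul_one, mul_assoc V, hR2, mul_one, hVU]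
  have hunit : w * z ∈ resolventSet ℂ S := ⟨⟨_, _, k1, k2⟩, rfl⟩
  refine ⟨hunit, fun n => ?_⟩
  have hres : resolvent S (w * z) = w⁻¹ • (V * resolvent S z * U) := by
    exact Ring.inverse_unit (⟨_, _, k1, k2⟩ : (E →L[ℂ] E)ˣ)
  have hU0 : U (e 0) = e 0 := by
    apply hι; ext n
    rw [hU', he]
    by_cases hn : n = 0
    · subst hn; simp
    · simp [hn]
  rw [hres]
  simp [hU0, hV', zpow_sub_one₀ hw0]
  ring

theorem aux_circle_comm {F G : Type*} [NormedAddCommGroup F] [NormedSpace ℂ F] [CompleteSpace F]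
    [NormedAddCommGroup G] [NormedSpace ℂ G] [CompleteSpace G] (L : F →L[ℂ] G)
    (f : ℂ → F) (r : ℝ) (hr : 0 ≤ r) (hf : ContinuousOn f (Metric.sphere 0 r)) :
    L (∮ z in C(0, r), f z) = ∮ z in C(0, r), L (f z) := by
  have h1 : CircleIntegrable f 0 r := hf.circleIntegrable hr
  have h2 := h1.out
  unfold circleIntegral
  rw [← ContinuousLinearMap.intervalIntegral_comp_comm L h2]
  simp

/-- The spectrum of the shift has no circular gap. -/
theorem aux_spec {E : Type*} [NormedAddCommGroup E] [NormedSpace ℂ E] [CompleteSpace E]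
    (ι : E →ₗ[ℂ] (ℤ → ℂ)) (hι : Function.Injective ι)
    (e : ℤ → E) (he : ∀ k : ℤ, ι (e k) = Pi.single k 1)
    (hdense : Dense (Submodule.span ℂ (Set.range e) : Set E))
    (hcoord : ∀ n : ℤ, Continuous fun x : E => ι x n)
    (Ψ : ℂ → E → E)
    (hΨ : ∀ z : ℂ, ‖z‖ = 1 → ∀ x : E, ∀ n : ℤ, ι (Ψ z x) n = ι x n * z ^ n)
    (hΨiso : ∀ z : ℂ, ‖z‖ = 1 → ∀ x : E, ‖Ψ z x‖ = ‖x‖)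
    (S : E →L[ℂ] E) (hS : ∀ x n, ι (S x) n = ι x (n - 1))
    (l₁ l₂ z : ℂ) (h₁ : l₁ ∈ spectrum ℂ S) (h₂ : l₂ ∈ spectrum ℂ S)
    (hz₁ : ‖l₁‖ < ‖z‖) (hz₂ : ‖z‖ < ‖l₂‖) : z ∈ spectrum ℂ S := by
  by_contra hz
  have hzr : z ∈ resolventSet ℂ S := by
    simpa [spectrum] using hz
  set r := ‖z‖ with hr
  have hr0 : 0 < r := (norm_nonneg _).trans_lt hz₁
  have hz0 : z ≠ 0 := by rw [← norm_pos_iff]; exact hr0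
  have hcirc : ∀ ζ ∈ Metric.sphere (0 : ℂ) r, ζ ∈ resolventSet ℂ S ∧
      ∀ n, ι (resolvent S ζ (e 0)) n = (ζ / z) ^ (-n - 1) * ι (resolvent S z (e 0)) n := by
    intro ζ hζ
    have hζ' : ‖ζ‖ = r := by simpa using hζ
    have := aux_rot_res ι hι e he Ψ hΨ hΨiso S hS z (ζ / z)
      (by rw [norm_div, hζ', ← hr, div_self hr0.ne']) hzr
    rwa [div_mul_cancel₀ _ hz0] at this
  have hcont : ContinuousOn (resolvent S) (Metric.sphere (0 : ℂ) r) := fun ζ hζ =>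
    (spectrum.hasDerivAt_resolvent_const_left (hcirc ζ hζ).1).continuousAt.continuousWithinAt
  set P : E →L[ℂ] E := ∮ ζ in C(0, r), resolvent S ζ with hP
  have hSinj : ∀ x y, S x = S y → x = y := by
    intro x y h
    apply hι; ext n
    have := congrArg (fun v => ι v (n + 1)) h
    simpa [hS] using this
  have hSe : ∀ k, S (e k) = e (k + 1) := by
    intro k; apply hι; ext n
    rw [hS, he, he]
    simp only [Pi.single_apply, sub_eq_iff_eq_add]
  -- commutation
  have hcomm : ∀ ζ : ℂ, Commute S (resolvent S ζ) := by
    intro ζ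
    have h0 : Commute S (algebraMap ℂ (E →L[ℂ] E) ζ) := Algebra.commute_algebraMap_right ζ S
    have h : Commute S (algebraMap ℂ (E →L[ℂ] E) ζ - S) := h0.sub_right (Commute.refl S)
    unfold resolvent
    by_cases hu : IsUnit (algebraMap ℂ (E →L[ℂ] E) ζ - S)
    · obtain ⟨u, hu⟩ := hu
      rw [← hu] at h ⊢
      rw [Ring.inverse_unit]
      exact h.units_inv_right
    · rw [Ring.inverse_non_unit _ hu]
      exact Commute.zero_right S
  have hPS : P * S = S * P := by
    have a1 := aux_circle_comm (ContinuousLinearMap.mul ℂ (E →L[ℂ] E) S) _ r hr0.le hcont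
    have a2 := aux_circle_comm ((ContinuousLinearMap.mul ℂ (E →L[ℂ] E)).flip S) _ r hr0.le hcont
    simp only [ContinuousLinearMap.mul_apply', ContinuousLinearMap.flip_apply] at a1 a2
    rw [hP, a1, a2]
    congr 1
    ext1 ζ
    exact (hcomm ζ).symm
  have hPe0 : ∀ n, n ≠ 0 → ι (P (e 0)) n = 0 := by
    intro n hn
    let L : (E →L[ℂ] E) →L[ℂ] ℂ :=
      (⟨(LinearMap.proj n).comp ι, hcoord n⟩ : E →L[ℂ] ℂ).comp
        (ContinuousLinearMap.apply ℂ E (e 0))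
    have hL : ∀ B, L B = ι (B (e 0)) n := fun B => rfl
    have a := aux_circle_comm L _ r hr0.le hcont
    rw [← hP, hL] at a
    rw [a]
    have : ∮ ζ in C(0, r), L (resolvent S ζ) =
        ∮ ζ in C(0, r), (z⁻¹ ^ (-n - 1) * ι (resolvent S z (e 0)) n) * (ζ - 0) ^ (-n - 1) := by
      refine circleIntegral.integral_congr hr0.le fun ζ hζ => ?_
      simp only [hL]
      rw [(hcirc ζ hζ).2 n, div_eq_mul_inv, mul_zpow, sub_zero]
      ring
    rw [this, circleIntegral.integral_const_mul,
      circleIntegral.integral_sub_zpow_of_ne (by omega), mul_zero]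
  obtain ⟨c, hc⟩ : ∃ c, c = ι (P (e 0)) 0 := ⟨_, rfl⟩
  have hPk : ∀ k, P (e k) = c • e k := by
    intro k
    induction k using Int.induction_on with
    | zero =>
      apply hι; ext n
      by_cases hn : n = 0
      · subst hn; simp [he, hc]
      · simp [he, hPe0 n hn, hn]
    | succ k ih =>
      rw [← hSe, ← mul_apply_eq_comp, hPS, mul_apply_eq_comp, ih, map_smul]
    | pred k ih =>
      apply hSinj
      rw [← mul_apply_eq_comp, ← hPS, mul_apply_eq_comp, hSe, map_smul, hSe,
        sub_add_cancel, ih]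
  have hPc : P = c • (1 : E →L[ℂ] E) := aux_ext e hdense _ _ (fun k => by simp [hPk k])
  -- the main identity
  have main : ∀ l : ℂ, ‖l‖ ≠ r → l ∈ spectrum ℂ S →
      c = ∮ ζ in C(0, r), (ζ - l)⁻¹ := by
    intro l hl hls
    by_contra hne
    have hsub : ∀ ζ ∈ Metric.sphere (0 : ℂ) r, ζ - l ≠ 0 := by
      intro ζ hζ h
      rw [sub_eq_zero] at h
      subst h
      exact hl (by simpa using hζ)
    have hcinv : ContinuousOn (fun ζ : ℂ => (ζ - l)⁻¹) (Metric.sphere 0 r) :=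
      ContinuousOn.inv₀ (by fun_prop) hsub
    have hcq : ContinuousOn (fun ζ : ℂ => (ζ - l)⁻¹ • resolvent S ζ) (Metric.sphere 0 r) :=
      hcinv.smul hcont
    set Q : E →L[ℂ] E := ∮ ζ in C(0, r), (ζ - l)⁻¹ • resolvent S ζ with hQ
    set A : E →L[ℂ] E := S - algebraMap ℂ _ l with hA
    have a1 := aux_circle_comm (ContinuousLinearMap.mul ℂ (E →L[ℂ] E) A) _ r hr0.le hcq
    have a2 := aux_circle_comm ((ContinuousLinearMap.mul ℂ (E →L[ℂ] E)).flip A) _ r hr0.le hcq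
    simp only [ContinuousLinearMap.mul_apply', ContinuousLinearMap.flip_apply] at a1 a2
    have hid : ∀ ζ ∈ Metric.sphere (0 : ℂ) r,
        A * ((ζ - l)⁻¹ • resolvent S ζ) = resolvent S ζ - (ζ - l)⁻¹ • (1 : E →L[ℂ] E) := by
      intro ζ hζ
      have hR1 : (algebraMap ℂ (E →L[ℂ] E) ζ - S) * resolvent S ζ = 1 :=
        Ring.mul_inverse_cancel _ (hcirc ζ hζ).1
      have : A = (ζ - l) • (1 : E →L[ℂ] E) - (algebraMap ℂ (E →L[ℂ] E) ζ - S) := by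
        rw [hA, Algebra.algebraMap_eq_smul_one, Algebra.algebraMap_eq_smul_one, sub_smul]
        abel
      rw [mul_smul_comm, this, sub_mul, hR1, smul_mul_assoc, one_mul, smul_sub, smul_smul,
        inv_mul_cancel₀ (hsub ζ hζ), one_smul]
    have hAQ : A * Q = (c - ∮ ζ in C(0, r), (ζ - l)⁻¹) • (1 : E →L[ℂ] E) := by
      have hc1 : ContinuousOn (fun ζ : ℂ => (ζ - l)⁻¹ • (1 : E →L[ℂ] E)) (Metric.sphere 0 r) :=
        hcinv.smul continuousOn_const
      rw [a1, circleIntegral.integral_congr hr0.le hid, circleIntegral.integral_sub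
        (hcont.circleIntegrable hr0.le) (hc1.circleIntegrable hr0.le),
        circleIntegral.integral_smul_const, ← hP, hPc, sub_smul]
    have hQA : Q * A = A * Q := by
      rw [a1, a2]
      congr 1
      ext1 ζ
      have : Commute A (resolvent S ζ) := (hcomm ζ).sub_left (Algebra.commute_algebraMap_left l _)
      rw [smul_mul_assoc, mul_smul_comm, this.eq]
    have hd : c - ∮ ζ in C(0, r), (ζ - l)⁻¹ ≠ 0 := sub_ne_zero.2 hne
    set d := c - ∮ ζ in C(0, r), (ζ - l)⁻¹
    have hu : IsUnit A := ⟨⟨A, d⁻¹ • Q, by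
      rw [mul_smul_comm, hAQ, smul_smul, inv_mul_cancel₀ hd, one_smul], by
      rw [smul_mul_assoc, hQA, hAQ, smul_smul, inv_mul_cancel₀ hd, one_smul]⟩, rfl⟩
    apply hls
    have := hu.neg
    rwa [hA, neg_sub] at this
  have m1 := main l₁ hz₁.ne h₁
  have m2 := main l₂ hz₂.ne' h₂
  rw [circleIntegral.integral_sub_inv_of_mem_ball (by simpa using hz₁)] at m1
  have h0 : ∮ ζ in C(0, r), (ζ - l₂)⁻¹ = 0 := by
    apply DiffContOnCl.circleIntegral_eq_zero hr0.le
    refine DifferentiableOn.diffContOnCl fun ζ hζ => ?_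
    refine DifferentiableAt.differentiableWithinAt ?_
    refine DifferentiableAt.inv (by fun_prop) ?_
    intro h
    rw [sub_eq_zero] at h
    subst h
    have := Metric.closure_ball_subset_closedBall hζ
    simp at this
    linarith
  rw [h0, m1] at m2
  simp [Real.pi_ne_zero] at m2

/-- A bounded Laurent polynomial in the shift dominates its symbol on the spectrum. -/
theorem aux_symbol {E : Type*} [NormedAddCommGroup E] [NormedSpace ℂ E] [CompleteSpace E]
    (ι : E →ₗ[ℂ] (ℤ → ℂ)) (hι : Function.Injective ι)
    (e : ℤ → E) (he : ∀ k : ℤ, ι (e k) = Pi.single k 1)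
    (hdense : Dense (Submodule.span ℂ (Set.range e) : Set E))
    (S : E →L[ℂ] E) (hS : ∀ x n, ι (S x) n = ι x (n - 1))
    (B : E →L[ℂ] E) (c : ℤ → ℂ) (hB : ∀ k n, ι (B (e k)) n = c (n - k))
    (N : ℕ) (hc : ∀ n : ℤ, N < n.natAbs → c n = 0) (z : ℂ) (hz0 : z ≠ 0)
    (hz : z ∈ spectrum ℂ S) :
    ‖∑ j ∈ Finset.range (2 * N + 1), c (j - N) * z ^ ((j : ℤ) - N)‖ ≤ ‖B‖ := by
  have hnt : Nontrivial E := by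
    refine ⟨e 0, 0, fun h => ?_⟩
    have := congrFun (he 0) 0
    rw [h] at this
    simp at this
  set μ := ∑ j ∈ Finset.range (2 * N + 1), c (j - N) * z ^ ((j : ℤ) - N) with hμ
  by_contra hlt
  rw [not_le] at hlt
  have hres : IsUnit (algebraMap ℂ (E →L[ℂ] E) μ - B) := spectrum.mem_resolventSet_of_norm_lt hlt
  have hSj : ∀ (j : ℕ) x n, ι ((S ^ j) x) n = ι x (n - j) := by
    intro j
    induction j with
    | zero => intro x n; simp
    | succ j ih =>
      intro x n
      rw [pow_succ', mul_apply_eq_comp, hS, ih]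
      congr 1
      push_cast
      ring_nf
  have hSe : ∀ k, S (e k) = e (k + 1) := by
    intro k; apply hι; ext n
    rw [hS, he, he]
    simp only [Pi.single_apply, sub_eq_iff_eq_add]
  have hSB : Commute S B := by
    refine aux_ext e hdense _ _ fun k => hι ?_
    ext n
    rw [mul_apply_eq_comp, mul_apply_eq_comp, hS, hSe, hB, hB]
    congr 1
    ring
  set p : Polynomial ℂ := ∑ j ∈ Finset.range (2 * N + 1),
    Polynomial.C (c (j - N)) * Polynomial.X ^ j with hp
  have hpS : S ^ N * B = Polynomial.aeval S p := by
    refine aux_ext e hdense _ _ fun k => hι ?_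
    ext n
    rw [mul_apply_eq_comp, hSj, hB]
    have : Polynomial.aeval S p = ∑ j ∈ Finset.range (2 * N + 1), c (j - N) • S ^ j := by
      simp [hp, Algebra.smul_def]
    rw [this]
    simp only [_root_.sum_apply, map_sum, Finset.sum_apply,
      _root_.smul_apply, map_smul, Pi.smul_apply, hSj, he, Pi.single_apply, smul_eq_mul]
    by_cases hr : 0 ≤ n - k ∧ n - k ≤ 2 * N
    · rw [Finset.sum_eq_single_of_mem (n - k).toNat (by simp; omega)]
      · rw [if_pos (by omega), mul_one]
        congr 1
        omega
      · intro j hj hne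
        rw [if_neg (by omega), mul_zero]
    · rw [hc _ (by omega)]
      symm
      refine Finset.sum_eq_zero fun j hj => ?_
      rw [Finset.mem_range] at hj
      rw [if_neg (by omega), mul_zero]
  have hpz : p.eval z = z ^ N * μ := by
    rw [hp, hμ, Polynomial.eval_finsetSum, Finset.mul_sum]
    refine Finset.sum_congr rfl fun j _ => ?_
    rw [zpow_sub₀ hz0]
    simp
    field_simp
  obtain ⟨q, hq⟩ : Polynomial.X - Polynomial.C z ∣ Polynomial.C μ * Polynomial.X ^ N - p := by
    rw [Polynomial.dvd_iff_isRoot]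
    rw [Polynomial.IsRoot.def, Polynomial.eval_sub, Polynomial.eval_mul, Polynomial.eval_C,
      Polynomial.eval_pow, Polynomial.eval_X, hpz, mul_comm, sub_self]
  obtain ⟨q₂, hq₂⟩ : Polynomial.X - Polynomial.C z ∣
      (Polynomial.X ^ N - Polynomial.C (z ^ N) : Polynomial ℂ) := by
    rw [Polynomial.dvd_iff_isRoot]
    simp
  obtain ⟨u, hu⟩ := hres
  have e1 : S ^ N * (u : E →L[ℂ] E) = (S - algebraMap ℂ _ z) * Polynomial.aeval S q := by
    have := congrArg (Polynomial.aeval S) hq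
    simp only [map_sub, map_mul, Polynomial.aeval_X, Polynomial.aeval_C, map_pow] at this
    rw [← this, hu, mul_sub, hpS, Algebra.commutes]
  have e2 : S ^ N - algebraMap ℂ _ (z ^ N) = (S - algebraMap ℂ _ z) * Polynomial.aeval S q₂ := by
    have := congrArg (Polynomial.aeval S) hq₂
    simpa only [map_sub, map_mul, Polynomial.aeval_X, Polynomial.aeval_C, map_pow] using this
  set W : E →L[ℂ] E := Polynomial.aeval S q * (↑u⁻¹ : E →L[ℂ] E) - Polynomial.aeval S q₂ with hW
  have e3 : (S - algebraMap ℂ _ z) * W = algebraMap ℂ _ (z ^ N) := by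
    rw [hW, mul_sub, ← e2, ← mul_assoc, ← e1, mul_assoc, Units.mul_inv, mul_one, sub_sub_cancel]
  have cpoly : ∀ q : Polynomial ℂ, Commute S (Polynomial.aeval S q) := by
    intro q
    have : Commute (Polynomial.aeval S (Polynomial.X : Polynomial ℂ)) (Polynomial.aeval S q) := by
      rw [Commute, SemiconjBy, ← map_mul, ← map_mul, mul_comm]
    rwa [Polynomial.aeval_X] at this
  have cu : Commute S (u : E →L[ℂ] E) := by
    rw [hu]
    exact (Algebra.commute_algebraMap_right μ S).sub_right hSB
  have cW : Commute S W := ((cpoly q).mul_right cu.units_inv_right).sub_right (cpoly q₂)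
  have cW' : Commute (S - algebraMap ℂ _ z) W := cW.sub_left (Algebra.commute_algebraMap_left z W)
  have hzN : z ^ N ≠ 0 := pow_ne_zero _ hz0
  have hunit : IsUnit (S - algebraMap ℂ (E →L[ℂ] E) z) := by
    have t1 : (S - algebraMap ℂ _ z) * ((z ^ N)⁻¹ • W) = 1 := by
      rw [mul_smul_comm, e3, Algebra.algebraMap_eq_smul_one, smul_smul, inv_mul_cancel₀ hzN,
        one_smul]
    refine ⟨⟨_, (z ^ N)⁻¹ • W, t1, ?_⟩, rfl⟩
    rw [smul_mul_assoc, ← cW'.eq, ← mul_smul_comm, t1]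
  apply hz
  have := hunit.neg
  rwa [neg_sub] at this

/-- Strong continuity of the rotation group. -/
theorem aux_cont {E : Type*} [NormedAddCommGroup E] [NormedSpace ℂ E]
    (ι : E →ₗ[ℂ] (ℤ → ℂ)) (hι : Function.Injective ι)
    (e : ℤ → E) (he : ∀ k : ℤ, ι (e k) = Pi.single k 1)
    (hdense : Dense (Submodule.span ℂ (Set.range e) : Set E))
    (U : ℝ → E →L[ℂ] E)
    (hU : ∀ θ x n, ι (U θ x) n = ι x n * (Complex.exp (θ * Complex.I)) ^ n)
    (hUiso : ∀ θ x, ‖U θ x‖ = ‖x‖) (x : E) : Continuous fun θ => U θ x := by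
  have hspan : ∀ y ∈ Submodule.span ℂ (Set.range e), Continuous fun θ => U θ y := by
    intro y hy
    induction hy using Submodule.span_induction with
    | mem y hy =>
      obtain ⟨k, rfl⟩ := hy
      have : (fun θ => U θ (e k)) = fun θ : ℝ => (Complex.exp (θ * Complex.I)) ^ k • e k := by
        ext θ
        apply hι
        ext n
        rw [hU, he]
        by_cases hn : n = k
        · subst hn; simp [he]
        · simp [hn, he]
      rw [this]
      refine Continuous.smul ?_ continuous_const
      refine Continuous.zpow₀ (by fun_prop) k fun θ => Or.inl (Complex.exp_ne_zero _)
    | zero => simp only [map_zero]; exact continuous_const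
    | add a b _ _ ha hb => simp only [map_add]; exact ha.add hb
    | smul a b _ hb => simp only [map_smul]; exact hb.const_smul a
  refine continuous_of_uniform_approx_of_continuous fun u hu => ?_
  obtain ⟨ε, hε, hεu⟩ := Metric.mem_uniformity_dist.1 hu
  obtain ⟨y, hy, hxy⟩ := Metric.mem_closure_iff.1 (hdense x) ε hε
  refine ⟨fun θ => U θ y, hspan y hy, fun θ => hεu ?_⟩
  rw [dist_eq_norm, ← map_sub, hUiso, ← dist_eq_norm]
  exact hxy

/-- Averaging a multiplier over rotations against a kernel. -/
theorem aux_avg {E : Type*} [NormedAddCommGroup E] [NormedSpace ℂ E] [CompleteSpace E]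
    (ι : E →ₗ[ℂ] (ℤ → ℂ)) (hι : Function.Injective ι)
    (e : ℤ → E) (he : ∀ k : ℤ, ι (e k) = Pi.single k 1)
    (hdense : Dense (Submodule.span ℂ (Set.range e) : Set E))
    (hcoord : ∀ n : ℤ, Continuous fun x : E => ι x n)
    (Ψ : ℂ → E → E)
    (hΨ : ∀ z : ℂ, ‖z‖ = 1 → ∀ x : E, ∀ n : ℤ, ι (Ψ z x) n = ι x n * z ^ n)
    (hΨiso : ∀ z : ℂ, ‖z‖ = 1 → ∀ x : E, ‖Ψ z x‖ = ‖x‖)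
    (M : E →L[ℂ] E) (m : ℤ → ℂ)
    (hM : ∀ k n : ℤ, ι (M (e k)) n = m (n - k))
    (K : ℝ → ℂ) (hK : Continuous K) (hK1 : ∫ θ in (0 : ℝ)..2 * Real.pi, ‖K θ‖ ≤ 2 * Real.pi) :
    ∃ B : E →L[ℂ] E, ‖B‖ ≤ ‖M‖ ∧ ∀ k n, ι (B (e k)) n =
      (2 * Real.pi : ℂ)⁻¹ * (∫ θ in (0 : ℝ)..2 * Real.pi,
        K θ * Complex.exp (θ * Complex.I) ^ (n - k)) * m (n - k) := by
  have hu : ∀ θ : ℝ, ‖Complex.exp (θ * Complex.I)‖ = 1 := Complex.norm_exp_ofReal_mul_I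
  choose U hU0 using fun θ : ℝ => aux_rot ι hι Ψ hΨ hΨiso _ (hu θ)
  have hU : ∀ (θ : ℝ) x n, ι (U θ x) n = ι x n * (Complex.exp (θ * Complex.I)) ^ n :=
    fun θ x n => by rw [hU0, hΨ _ (hu θ)]
  have hUiso : ∀ θ x, ‖U θ x‖ = ‖x‖ := fun θ x => by rw [hU0, hΨiso _ (hu θ)]
  have hUc := aux_cont ι hι e he hdense U hU hUiso
  have hg : ∀ x, Continuous fun θ => K θ • U θ (M (U (-θ) x)) := by
    intro x
    refine hK.smul ?_
    have h1 : Continuous fun θ => M (U (-θ) x) := M.continuous.comp ((hUc x).comp continuous_neg)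
    rw [continuous_iff_continuousAt]
    intro θ₀
    rw [ContinuousAt, tendsto_iff_norm_sub_tendsto_zero]
    have l1 : Filter.Tendsto (fun θ => ‖M (U (-θ) x) - M (U (-θ₀) x)‖) (nhds θ₀) (nhds 0) :=
      tendsto_iff_norm_sub_tendsto_zero.1 (h1.tendsto θ₀)
    have l2 : Filter.Tendsto (fun θ => ‖U θ (M (U (-θ₀) x)) - U θ₀ (M (U (-θ₀) x))‖)
        (nhds θ₀) (nhds 0) :=
      tendsto_iff_norm_sub_tendsto_zero.1 ((hUc (M (U (-θ₀) x))).tendsto θ₀)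
    have l3 := l1.add l2
    rw [add_zero] at l3
    refine squeeze_zero (fun _ => norm_nonneg _) (fun θ => ?_) l3
    rw [← hUiso θ (M (U (-θ) x) - M (U (-θ₀) x)), map_sub]
    exact norm_sub_le_norm_sub_add_norm_sub _ _ _
  have hgi : ∀ x, IntervalIntegrable (fun θ => K θ • U θ (M (U (-θ) x))) MeasureTheory.volume
      0 (2 * Real.pi) := fun x => (hg x).intervalIntegrable _ _
  let L : E →ₗ[ℂ] E :=
    { toFun := fun x => (2 * Real.pi : ℂ)⁻¹ • ∫ θ in (0 : ℝ)..2 * Real.pi,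
        K θ • U θ (M (U (-θ) x))
      map_add' := fun x y => by
        simp only [map_add, smul_add]
        rw [intervalIntegral.integral_add (hgi x) (hgi y), smul_add]
      map_smul' := fun a x => by
        simp only [map_smul, RingHom.id_apply]
        simp only [smul_comm _ a]
        rw [intervalIntegral.integral_smul, smul_comm] }
  have hL : ∀ x, L x = (2 * Real.pi : ℂ)⁻¹ • ∫ θ in (0 : ℝ)..2 * Real.pi,
        K θ • U θ (M (U (-θ) x)) := fun x => rfl
  have hpi : (0 : ℝ) < 2 * Real.pi := by positivity
  have hb : ∀ x, ‖L x‖ ≤ ‖M‖ * ‖x‖ := by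
    intro x
    have h1 : ‖∫ θ in (0 : ℝ)..2 * Real.pi, K θ • U θ (M (U (-θ) x))‖
        ≤ ∫ θ in (0 : ℝ)..2 * Real.pi, ‖K θ‖ * (‖M‖ * ‖x‖) := by
      refine intervalIntegral.norm_integral_le_of_norm_le hpi.le ?_
        ((hK.norm.mul continuous_const).intervalIntegrable _ _)
      refine Filter.Eventually.of_forall fun θ _ => ?_
      rw [norm_smul, hUiso]
      gcongr
      refine (M.le_opNorm _).trans ?_
      rw [hUiso]
    rw [intervalIntegral.integral_mul_const] at h1
    have h2 : ‖(2 * Real.pi : ℂ)⁻¹‖ = (2 * Real.pi)⁻¹ := by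
      rw [norm_inv]
      simp [abs_of_pos Real.pi_pos]
    rw [hL, norm_smul, h2, inv_mul_le_iff₀ hpi]
    exact h1.trans (by gcongr)
  refine ⟨L.mkContinuous ‖M‖ hb, L.mkContinuous_norm_le (norm_nonneg _) hb, fun k n => ?_⟩
  rw [LinearMap.mkContinuous_apply, hL, map_smul, Pi.smul_apply, smul_eq_mul, mul_assoc]
  congr 1
  have hcomp := ContinuousLinearMap.intervalIntegral_comp_comm
    (⟨(LinearMap.proj n).comp ι, hcoord n⟩ : E →L[ℂ] ℂ) (hgi (e k))
  have hcomp' : ∫ θ in (0 : ℝ)..2 * Real.pi, ι (K θ • U θ (M (U (-θ) (e k)))) n =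
    ι (∫ θ in (0 : ℝ)..2 * Real.pi, K θ • U θ (M (U (-θ) (e k)))) n := hcomp
  rw [← hcomp', ← intervalIntegral.integral_mul_const]
  congr 1
  ext θ
  have hUe : U (-θ) (e k) = Complex.exp (θ * Complex.I) ^ (-k) • e k := by
    apply hι
    ext j
    rw [hU, he]
    by_cases hj : j = k
    · subst hj
      simp [he, Complex.exp_neg]
    · simp [hj, he]
  rw [hUe, map_smul, map_smul, map_smul, map_smul]
  simp only [Pi.smul_apply, smul_eq_mul]
  rw [hU, hM, zpow_sub₀ (Complex.exp_ne_zero _), zpow_neg]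
  ring

theorem aux_orth (n : ℤ) : ∫ θ in (0 : ℝ)..2 * Real.pi, Complex.exp (θ * Complex.I) ^ n =
    if n = 0 then (2 * Real.pi : ℂ) else 0 := by
  split_ifs with h
  · subst h; simp
  · have h1 : ∀ θ : ℝ, Complex.exp (θ * Complex.I) ^ n = Complex.exp ((n * Complex.I) * θ) := by
      intro θ
      rw [← Complex.exp_int_mul]
      ring_nf
    simp only [h1]
    have hne : (n * Complex.I : ℂ) ≠ 0 := by simp [h]
    rw [integral_exp_mul_complex hne]
    have : (n * Complex.I * ((2 * Real.pi : ℝ) : ℂ)) = n * (2 * Real.pi * Complex.I) := by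
      push_cast; ring
    rw [this, Complex.exp_int_mul_two_pi_mul_I]
    simp

theorem aux_count (N : ℕ) (n : ℤ) :
    (∑ j ∈ Finset.range N, ∑ l ∈ Finset.range N, if ((j : ℤ) - l) + n = 0 then (1 : ℂ) else 0)
      = ((N - n.natAbs : ℕ) : ℂ) := by
  have h1 : ∀ j ∈ Finset.range N,
      (∑ l ∈ Finset.range N, if ((j : ℤ) - l) + n = 0 then (1 : ℂ) else 0) =
      if 0 ≤ (j : ℤ) + n ∧ (j : ℤ) + n < N then 1 else 0 := by
    intro j hj
    split_ifs with h
    · rw [Finset.sum_eq_single_of_mem ((j : ℤ) + n).toNat (by simp; omega)]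
      · rw [if_pos (by omega)]
      · intro l hl hne
        rw [if_neg (by omega)]
    · refine Finset.sum_eq_zero fun l hl => ?_
      rw [Finset.mem_range] at hl
      rw [if_neg (by omega)]
  rw [Finset.sum_congr rfl h1, Finset.sum_ite, Finset.sum_const_zero, add_zero, Finset.sum_const,
    nsmul_eq_mul, mul_one]
  congr 1
  rcases le_total 0 n with hn | hn
  · have : (Finset.range N).filter (fun j : ℕ => 0 ≤ (j : ℤ) + n ∧ (j : ℤ) + n < N)
        = Finset.range (N - n.natAbs) := by
      ext j; simp only [Finset.mem_filter, Finset.mem_range]; omega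
    rw [this, Finset.card_range]
  · have : (Finset.range N).filter (fun j : ℕ => 0 ≤ (j : ℤ) + n ∧ (j : ℤ) + n < N)
        = Finset.Ico n.natAbs N := by
      ext j; simp only [Finset.mem_filter, Finset.mem_range, Finset.mem_Ico]; omega
    rw [this, Nat.card_Ico]

/-- The Fejér kernel. -/
theorem aux_fejer (N : ℕ) (hN : 0 < N) : ∃ K : ℝ → ℂ, Continuous K ∧
    ∫ θ in (0 : ℝ)..2 * Real.pi, ‖K θ‖ ≤ 2 * Real.pi ∧
    ∀ n : ℤ, (2 * Real.pi : ℂ)⁻¹ * (∫ θ in (0 : ℝ)..2 * Real.pi,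
        K θ * Complex.exp (θ * Complex.I) ^ n) = ((N - n.natAbs : ℕ) : ℂ) / N := by
  have hN0 : (N : ℂ) ≠ 0 := by exact_mod_cast hN.ne'
  have hpi : (2 * Real.pi : ℂ) ≠ 0 := by simp [Real.pi_ne_zero]
  let u : ℝ → ℂ := fun θ => Complex.exp (θ * Complex.I)
  have hu0 : ∀ θ, u θ ≠ 0 := fun θ => Complex.exp_ne_zero _
  have huc : Continuous u := by fun_prop
  have hun : ∀ θ, ‖u θ‖ = 1 := Complex.norm_exp_ofReal_mul_I
  have huz : ∀ n : ℤ, Continuous fun θ => u θ ^ n := fun n =>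
    huc.zpow₀ n fun θ => Or.inl (hu0 θ)
  let K : ℝ → ℂ := fun θ => (N : ℂ)⁻¹ * ∑ j ∈ Finset.range N, ∑ l ∈ Finset.range N,
    u θ ^ ((j : ℤ) - l)
  have hKc : Continuous K := by
    refine continuous_const.mul ?_
    exact continuous_finsetSum _ fun j _ => continuous_finsetSum _ fun l _ => huz _
  have hcoef : ∀ n : ℤ, (2 * Real.pi : ℂ)⁻¹ * (∫ θ in (0 : ℝ)..2 * Real.pi,
        K θ * u θ ^ n) = ((N - n.natAbs : ℕ) : ℂ) / N := by
    intro n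
    have h1 : ∀ θ, K θ * u θ ^ n = (N : ℂ)⁻¹ * ∑ j ∈ Finset.range N, ∑ l ∈ Finset.range N,
        u θ ^ (((j : ℤ) - l) + n) := by
      intro θ
      simp only [K, mul_assoc, Finset.sum_mul, zpow_add₀ (hu0 θ)]
    simp only [h1]
    rw [intervalIntegral.integral_const_mul, intervalIntegral.integral_finsetSum]
    · have h2 : ∀ j ∈ Finset.range N, ∫ θ in (0 : ℝ)..2 * Real.pi,
          ∑ l ∈ Finset.range N, u θ ^ (((j : ℤ) - l) + n) =
          (2 * Real.pi : ℂ) * ∑ l ∈ Finset.range N,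
            if ((j : ℤ) - l) + n = 0 then (1 : ℂ) else 0 := by
        intro j _
        rw [intervalIntegral.integral_finsetSum, Finset.mul_sum]
        · refine Finset.sum_congr rfl fun l _ => ?_
          rw [aux_orth]
          simp
        · intro l _
          exact (huz _).intervalIntegrable _ _
      rw [Finset.sum_congr rfl h2, ← Finset.mul_sum, aux_count]
      field_simp
    · intro j _
      exact (continuous_finsetSum _ fun l _ => huz _).intervalIntegrable _ _
  refine ⟨K, hKc, ?_, hcoef⟩
  have hnorm : ∀ θ, ((‖K θ‖ : ℝ) : ℂ) = K θ := by
    intro θ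
    have hsq : K θ = (((N : ℝ)⁻¹ * ‖∑ j ∈ Finset.range N, u θ ^ (j : ℤ)‖ ^ 2 : ℝ) : ℂ) := by
      have hconj : (starRingEnd ℂ) (u θ) = (u θ)⁻¹ := by
        rw [Complex.inv_def, Complex.normSq_eq_norm_sq, hun]
        simp
      push_cast
      rw [← Complex.mul_conj', map_sum, Finset.sum_mul_sum]
      simp only [K]
      congr 1
      refine Finset.sum_congr rfl fun j _ => Finset.sum_congr rfl fun l _ => ?_
      rw [map_zpow₀, hconj, zpow_sub₀ (hu0 θ), inv_zpow, div_eq_mul_inv]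
    rw [hsq, Complex.norm_real, Real.norm_of_nonneg (by positivity)]
  have h0 := hcoef 0
  simp only [zpow_zero, mul_one, Int.natAbs_zero, Nat.sub_zero, div_self hN0] at h0
  have h1 : (∫ θ in (0 : ℝ)..2 * Real.pi, K θ) = 2 * Real.pi := by
    field_simp at h0
    exact h0
  have h2 : ((∫ θ in (0 : ℝ)..2 * Real.pi, ‖K θ‖ : ℝ) : ℂ) = ((2 * Real.pi : ℝ) : ℂ) := by
    rw [← intervalIntegral.integral_ofReal]
    simp only [hnorm]
    rw [h1]
    push_cast
    rfl
  exact (Complex.ofReal_injective h2).le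

theorem aux_symbol_tsum {E : Type*} [NormedAddCommGroup E] [NormedSpace ℂ E] [CompleteSpace E]
    (ι : E →ₗ[ℂ] (ℤ → ℂ)) (hι : Function.Injective ι)
    (e : ℤ → E) (he : ∀ k : ℤ, ι (e k) = Pi.single k 1)
    (hdense : Dense (Submodule.span ℂ (Set.range e) : Set E))
    (S : E →L[ℂ] E) (hS : ∀ x n, ι (S x) n = ι x (n - 1))
    (B : E →L[ℂ] E) (c : ℤ → ℂ) (hB : ∀ k n, ι (B (e k)) n = c (n - k))
    (N : ℕ) (hc : ∀ n : ℤ, N < n.natAbs → c n = 0) (z : ℂ) (hz0 : z ≠ 0)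
    (hz : z ∈ spectrum ℂ S) :
    ‖∑' n : ℤ, c n * z ^ n‖ ≤ ‖B‖ := by
  have h := aux_symbol ι hι e he hdense S hS B c hB N hc z hz0 hz
  have h2 : ∑' n : ℤ, c n * z ^ n =
      ∑ j ∈ Finset.range (2 * N + 1), c (j - N) * z ^ ((j : ℤ) - N) := by
    rw [tsum_eq_sum (s := (Finset.range (2 * N + 1)).image (fun j : ℕ => (j : ℤ) - N))]
    · rw [Finset.sum_image]
      intro a _ b _ hab
      simpa using hab
    · intro n hn
      rw [hc n, zero_mul]
      by_contra hcon
      apply hn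
      rw [Finset.mem_image]
      exact ⟨(n + N).toNat, by simp; omega, by omega⟩
  rwa [h2]

theorem aux_core {E : Type*} [NormedAddCommGroup E] [NormedSpace ℂ E] [CompleteSpace E]
    (ι : E →ₗ[ℂ] (ℤ → ℂ)) (hι : Function.Injective ι)
    (e : ℤ → E) (he : ∀ k : ℤ, ι (e k) = Pi.single k 1)
    (hdense : Dense (Submodule.span ℂ (Set.range e) : Set E))
    (hcoord : ∀ n : ℤ, Continuous fun x : E => ι x n)
    (Ψ : ℂ → E → E)
    (hΨ : ∀ z : ℂ, ‖z‖ = 1 → ∀ x : E, ∀ n : ℤ, ι (Ψ z x) n = ι x n * z ^ n)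
    (hΨiso : ∀ z : ℂ, ‖z‖ = 1 → ∀ x : E, ‖Ψ z x‖ = ‖x‖)
    (S : E →L[ℂ] E) (hS : ∀ x n, ι (S x) n = ι x (n - 1))
    (M : E →L[ℂ] E) (m : ℤ → ℂ)
    (hM : ∀ k n : ℤ, ι (M (e k)) n = m (n - k))
    (A : Set ℂ) (hA : ∀ z, z ∈ A ↔ ∃ l₁ ∈ spectrum ℂ S, ∃ l₂ ∈ spectrum ℂ S,
      ‖l₁‖ < ‖z‖ ∧ ‖z‖ < ‖l₂‖) :
    (∀ z ∈ A, HasSum (fun n : ℤ => m n * z ^ n) (∑' n : ℤ, m n * z ^ n)) ∧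
    DifferentiableOn ℂ (fun z => ∑' n : ℤ, m n * z ^ n) A ∧
    ∀ z ∈ A, ‖∑' n : ℤ, m n * z ^ n‖ ≤ ‖M‖ := by
  have hAspec : ∀ z ∈ A, z ∈ spectrum ℂ S ∧ z ≠ 0 := by
    intro z hz
    obtain ⟨l₁, h₁, l₂, h₂, h3, h4⟩ := (hA z).1 hz
    refine ⟨aux_spec ι hι e he hdense hcoord Ψ hΨ hΨiso S hS l₁ l₂ z h₁ h₂ h3 h4, ?_⟩
    rw [← norm_pos_iff]
    exact (norm_nonneg _).trans_lt h3
  -- coefficient estimate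
  have hcoef : ∀ z ∈ A, ∀ n, ‖m n‖ * ‖z‖ ^ n ≤ ‖M‖ := by
    intro z hz n
    obtain ⟨hzs, hz0⟩ := hAspec z hz
    obtain ⟨B, hBM, hB⟩ := aux_avg ι hι e he hdense hcoord Ψ hΨ hΨiso M m hM
      (fun θ => Complex.exp (θ * Complex.I) ^ (-n))
      (Continuous.zpow₀ (by fun_prop) _ fun θ => Or.inl (Complex.exp_ne_zero _))
      (by simp [norm_zpow, Complex.norm_exp_ofReal_mul_I])
    have hB' : ∀ k j, ι (B (e k)) j = (fun i => if i = n then m n else 0) (j - k) := by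
      intro k j
      rw [hB]
      have : ∀ θ : ℝ, Complex.exp (θ * Complex.I) ^ (-n) * Complex.exp (θ * Complex.I) ^ (j - k)
          = Complex.exp (θ * Complex.I) ^ (-n + (j - k)) := fun θ =>
        (zpow_add₀ (Complex.exp_ne_zero _) _ _).symm
      simp only [this]
      rw [aux_orth]
      have hpi : (2 * Real.pi : ℂ) ≠ 0 := by simp [Real.pi_ne_zero]
      by_cases h : j - k = n
      · rw [if_pos (by omega), if_pos h, inv_mul_cancel₀ hpi, one_mul, h]
      · rw [if_neg (by omega), if_neg h]
        simp
    have hsupp : ∀ i : ℤ, n.natAbs < i.natAbs → (fun i => if i = n then m n else 0) i = 0 := by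
      intro i hi
      refine if_neg ?_
      rintro rfl
      omega
    have := aux_symbol_tsum ι hι e he hdense S hS B _ hB' n.natAbs hsupp z hz0 hzs
    rw [tsum_eq_single n (fun i hi => by simp [hi])] at this
    simp only [if_true, norm_mul, norm_zpow] at this
    exact this.trans hBM
  -- local uniform bound
  have hloc : ∀ z ∈ A, ∃ a b : ℝ, a < ‖z‖ ∧ ‖z‖ < b ∧ 0 ≤ a ∧ ∃ u : ℤ → ℝ, Summable u ∧
      ∀ w : ℂ, a < ‖w‖ → ‖w‖ < b → w ∈ A ∧ ∀ n, ‖m n * w ^ n‖ ≤ u n := by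
    intro z hz
    obtain ⟨l₁, h₁, l₂, h₂, h3, h4⟩ := (hA z).1 hz
    obtain ⟨a, ha1, ha2⟩ := exists_between h3
    obtain ⟨a', ha1', ha2'⟩ := exists_between ha2
    obtain ⟨b, hb1, hb2⟩ := exists_between h4
    obtain ⟨b', hb1', hb2'⟩ := exists_between hb1
    have ha0 : 0 < a := (norm_nonneg _).trans_lt ha1
    have ha0' : 0 < a' := ha0.trans ha1'
    have hb0' : 0 < b' := ha0'.trans (ha2'.trans hb1')
    have hb0 : 0 < b := hb0'.trans hb2'
    have haA : ((a : ℝ) : ℂ) ∈ A := (hA _).2 ⟨l₁, h₁, l₂, h₂, by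
      simpa [abs_of_pos ha0] using ha1, by
      simpa [abs_of_pos ha0] using ha2.trans h4⟩
    have hbA : ((b : ℝ) : ℂ) ∈ A := (hA _).2 ⟨l₁, h₁, l₂, h₂, by
      simpa [abs_of_pos hb0] using h3.trans hb1, by
      simpa [abs_of_pos hb0] using hb2⟩
    have ca := hcoef _ haA
    have cb := hcoef _ hbA
    rw [Complex.norm_real, Real.norm_of_nonneg ha0.le] at ca
    rw [Complex.norm_real, Real.norm_of_nonneg hb0.le] at cb
    set t := max (a / a') (b' / b) with ht
    have ht0 : 0 ≤ t := le_max_of_le_left (by positivity)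
    have ht1 : t < 1 := max_lt ((div_lt_one ha0').2 ha1') ((div_lt_one hb0).2 hb2')
    have hsum : Summable fun n : ℕ => ‖M‖ * t ^ n :=
      (summable_geometric_of_lt_one ht0 ht1).mul_left _
    refine ⟨a', b', ha2', hb1', ha0'.le, fun n => ‖M‖ * t ^ n.natAbs, ?_, ?_⟩
    · refine Summable.of_nat_of_neg ?_ ?_
      · simpa using hsum
      · simpa using hsum
    · intro w hw1 hw2
      refine ⟨(hA _).2 ⟨l₁, h₁, l₂, h₂, ha1.trans (ha1'.trans hw1),
        hw2.trans (hb2'.trans hb2)⟩, fun n => ?_⟩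
      rw [norm_mul, norm_zpow]
      have hw0 : 0 < ‖w‖ := ha0'.trans hw1
      obtain ⟨k, rfl | rfl⟩ := n.eq_nat_or_neg
      · have c1 := cb k
        beta_reduce
        rw [Int.natAbs_natCast]
        rw [zpow_natCast] at c1 ⊢
        calc ‖m k‖ * ‖w‖ ^ k ≤ ‖m k‖ * (b * t) ^ k := by
              gcongr
              have : b' / b ≤ t := le_max_right _ _
              rw [div_le_iff₀ hb0] at this
              linarith
          _ = (‖m k‖ * b ^ k) * t ^ k := by ring
          _ ≤ ‖M‖ * t ^ k := by gcongr
      · have c1 := ca (-k)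
        beta_reduce
        rw [Int.natAbs_neg, Int.natAbs_natCast]
        rw [zpow_neg, zpow_natCast, ← inv_pow] at c1 ⊢
        calc ‖m (-k)‖ * ‖w‖⁻¹ ^ k ≤ ‖m (-k)‖ * (a⁻¹ * t) ^ k := by
              gcongr
              have h1 : a / a' ≤ t := le_max_left _ _
              have h2 : ‖w‖⁻¹ ≤ a'⁻¹ := by gcongr
              calc ‖w‖⁻¹ ≤ a'⁻¹ := h2
                _ = a⁻¹ * (a / a') := by field_simp
                _ ≤ a⁻¹ * t := by gcongr
          _ = (‖m (-k)‖ * a⁻¹ ^ k) * t ^ k := by ring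
          _ ≤ ‖M‖ * t ^ k := by gcongr
  have hsumm : ∀ z ∈ A, Summable fun n : ℤ => ‖m n * z ^ n‖ := by
    intro z hz
    obtain ⟨a, b, haz, hzb, _, u, hu, h⟩ := hloc z hz
    exact Summable.of_nonneg_of_le (fun _ => norm_nonneg _) (h z haz hzb).2 hu
  refine ⟨fun z hz => (hsumm z hz).of_norm.hasSum, ?_, ?_⟩
  · intro z hz
    obtain ⟨a, b, haz, hzb, ha0, u, hu, h⟩ := hloc z hz
    set V : Set ℂ := {w | a < ‖w‖ ∧ ‖w‖ < b} with hV
    have hVo : IsOpen V :=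
      (isOpen_lt continuous_const continuous_norm).inter
        (isOpen_lt continuous_norm continuous_const)
    have := Complex.differentiableOn_tsum_of_summable_norm (F := fun (n : ℤ) (w : ℂ) => m n * w ^ n)
      hu (U := V) (fun n w hw => by
        have hw0 : w ≠ 0 := by
          rw [← norm_pos_iff]; exact ha0.trans_lt hw.1
        exact ((differentiableAt_zpow.2 (Or.inl hw0)).const_mul (m n)).differentiableWithinAt)
      hVo (fun n w hw => (h w hw.1 hw.2).2 n)
    exact ((this z ⟨haz, hzb⟩).differentiableAt
      (hVo.mem_nhds ⟨haz, hzb⟩)).differentiableWithinAt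
  · intro z hz
    obtain ⟨hzs, hz0⟩ := hAspec z hz
    have hlim : Filter.Tendsto (fun N : ℕ => ∑' n : ℤ,
        (((N - n.natAbs : ℕ) : ℂ) / N * m n) * z ^ n) Filter.atTop
        (nhds (∑' n : ℤ, m n * z ^ n)) := by
      refine tendsto_tsum_of_dominated_convergence (hsumm z hz) ?_ ?_
      · intro n
        have h1 : Filter.Tendsto (fun N : ℕ => (((N - n.natAbs : ℕ) : ℂ) / N))
            Filter.atTop (nhds 1) := by
          have h2 : Filter.Tendsto (fun N : ℕ => (1 : ℂ) - (n.natAbs : ℂ) / N)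
              Filter.atTop (nhds (1 - 0)) :=
            tendsto_const_nhds.sub (tendsto_const_div_atTop_nhds_zero_nat _)
          rw [sub_zero] at h2
          refine h2.congr' ?_
          filter_upwards [Filter.eventually_ge_atTop (n.natAbs + 1)] with N hN
          have : (N : ℂ) ≠ 0 := by
            have : N ≠ 0 := by omega
            exact_mod_cast this
          rw [Nat.cast_sub (by omega)]
          field_simp
        have h3 := (h1.mul_const (m n)).mul_const (z ^ n)
        rwa [one_mul] at h3
      · refine Filter.Eventually.of_forall fun N n => ?_
        rw [mul_assoc, norm_mul]
        refine mul_le_of_le_one_left (norm_nonneg _) ?_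
        rw [norm_div, Complex.norm_natCast, Complex.norm_natCast]
        refine div_le_one_of_le₀ ?_ (by positivity)
        exact_mod_cast Nat.sub_le _ _
    refine le_of_tendsto hlim.norm ?_
    filter_upwards [Filter.eventually_gt_atTop 0] with N hN
    obtain ⟨K, hK, hK1, hK2⟩ := aux_fejer N hN
    obtain ⟨B, hBM, hB⟩ := aux_avg ι hι e he hdense hcoord Ψ hΨ hΨiso M m hM K hK hK1
    have hB' : ∀ k j, ι (B (e k)) j =
        (fun n : ℤ => ((N - n.natAbs : ℕ) : ℂ) / N * m n) (j - k) := by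
      intro k j
      rw [hB, hK2]
    refine (aux_symbol_tsum ι hι e he hdense S hS B _ hB' N ?_ z hz0 hzs).trans hBM
    intro n hn
    have : N - n.natAbs = 0 := by omega
    simp [this]

theorem aux_closure {E : Type*} [NormedAddCommGroup E] [NormedSpace ℂ E]
    (A : E →ₗ.[ℂ] E) (g : E →L[ℂ] E × E) (hclosed : IsClosed (Set.range g))
    (hfun : ∀ x, (g x).1 = 0 → (g x).2 = 0) (D : Submodule ℂ E) (hD : Dense (D : Set E))
    (hA : ∀ p, p ∈ A.graph ↔ ∃ x ∈ D, g x = p) (p : E × E) :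
    p ∈ A.closure.graph ↔ ∃ x, g x = p := by
  have h1 : A.graph.topologicalClosure = LinearMap.range (g : E →ₗ[ℂ] E × E) := by
    apply le_antisymm
    · refine Submodule.topologicalClosure_minimal _ ?_ ?_
      · intro q hq
        obtain ⟨x, _, hx⟩ := (hA q).1 hq
        exact ⟨x, hx⟩
      · exact hclosed
    · rintro _ ⟨x, rfl⟩
      exact map_mem_closure g.continuous (hD x) (fun y hy => (hA _).2 ⟨y, hy, rfl⟩)
  have h2 : A.IsClosable := by
    refine ⟨(LinearMap.range (g : E →ₗ[ℂ] E × E)).toLinearPMap, ?_⟩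
    rw [h1, Submodule.toLinearPMap_graph_eq]
    rintro _ ⟨x, rfl⟩ hx
    exact hfun x hx
  rw [← h2.graph_closure_eq_closure_graph, h1]
  exact Iff.rfl

theorem aux_pSpec {E : Type*} [NormedAddCommGroup E] [NormedSpace ℂ E]
    (A : E →ₗ.[ℂ] E) (g : E →L[ℂ] E × E) (hA : ∀ p, p ∈ A.graph ↔ ∃ x, g x = p)
    (hinj : Function.Injective fun x => (g x).1) (l : ℂ) :
    l ∈ pSpec A ↔ ¬ Function.Bijective fun x => (g x).2 - l • (g x).1 := by
  have hex : ∀ x, ∃ y : A.domain, (y : E) = (g x).1 ∧ A y = (g x).2 := fun x =>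
    A.mem_graph_iff.1 ((hA _).2 ⟨x, rfl⟩)
  choose φ hφ1 hφ2 using hex
  have hφ : Function.Bijective φ := by
    constructor
    · intro x y h
      apply hinj
      change (g x).1 = (g y).1
      rw [← hφ1, ← hφ1, h]
    · intro y
      obtain ⟨x, hx⟩ := (hA _).1 (A.mem_graph y)
      refine ⟨x, Subtype.ext ?_⟩
      rw [hφ1, hx]
  unfold pSpec
  rw [Set.mem_ofPred_eq, ← Function.Bijective.of_comp_iff _ hφ]
  have : ((fun x : A.domain => A x - l • (x : E)) ∘ φ) = fun x => (g x).2 - l • (g x).1 := by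
    ext x
    simp [hφ1, hφ2]
  rw [this]

/-- The theorem when the forward shift is bounded. -/
theorem aux_bounded
    {E : Type*} [NormedAddCommGroup E] [NormedSpace ℂ E] [CompleteSpace E]
    (ι : E →ₗ[ℂ] (ℤ → ℂ)) (hι : Function.Injective ι)
    (e : ℤ → E) (he : ∀ k : ℤ, ι (e k) = Pi.single k 1)
    (hdense : Dense (Submodule.span ℂ (Set.range e) : Set E))
    (hcoord : ∀ n : ℤ, Continuous fun x : E => ι x n)
    (Ψ : ℂ → E → E)
    (hΨ : ∀ z : ℂ, ‖z‖ = 1 → ∀ x : E, ∀ n : ℤ, ι (Ψ z x) n = ι x n * z ^ n)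
    (hΨiso : ∀ z : ℂ, ‖z‖ = 1 → ∀ x : E, ‖Ψ z x‖ = ‖x‖)
    (S0 T0 : E →ₗ.[ℂ] E)
    (hS0dom : S0.domain = Submodule.span ℂ (Set.range e))
    (hS0 : ∀ x : S0.domain, ∀ n : ℤ, ι (S0 x) n = ι (x : E) (n - 1))
    (hT0dom : T0.domain = Submodule.span ℂ (Set.range e))
    (hT0 : ∀ x : T0.domain, ∀ n : ℤ, ι (T0 x) n = ι (x : E) (n + 1))
    (hb : (∀ x : E, ∃ y : E, ∀ n : ℤ, ι y n = ι x (n - 1)))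
    (M : E →L[ℂ] E)
    (hM : ∀ k n : ℤ, ι (M (e (k + 1))) n = ι (M (e k)) (n - 1)) :
    ∃ f : ℂ → ℂ,
      (∀ z ∈ {z : ℂ | (pRad T0.closure)⁻¹ < (‖z‖₊ : ℝ≥0∞) ∧ (‖z‖₊ : ℝ≥0∞) < pRad S0.closure},
        HasSum (fun n : ℤ => ι (M (e 0)) n * z ^ n) (f z)) ∧
      DifferentiableOn ℂ f
        {z : ℂ | (pRad T0.closure)⁻¹ < (‖z‖₊ : ℝ≥0∞) ∧ (‖z‖₊ : ℝ≥0∞) < pRad S0.closure} ∧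
      ∀ z ∈ {z : ℂ | (pRad T0.closure)⁻¹ < (‖z‖₊ : ℝ≥0∞) ∧ (‖z‖₊ : ℝ≥0∞) < pRad S0.closure},
        ‖f z‖ ≤ ‖M‖ := by
  obtain ⟨S, hS⟩ := aux_shift ι hι hcoord hb
  have hSinj : Function.Injective S := by
    intro x y h
    apply hι; ext n
    have := congrArg (fun v => ι v (n + 1)) h
    simpa [hS] using this
  have hSe : ∀ k, S (e k) = e (k + 1) := by
    intro k; apply hι; ext n
    rw [hS, he, he]
    simp only [Pi.single_apply, sub_eq_iff_eq_add]
  have hm : ∀ k n : ℤ, ι (M (e k)) n = ι (M (e 0)) (n - k) := by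
    intro k
    induction k using Int.induction_on with
    | zero => simp
    | succ k ih => intro n; rw [hM, ih]; congr 1; ring
    | pred k ih =>
      intro n
      have := hM (-k - 1) (n + 1)
      rw [sub_add_cancel, add_sub_cancel_right, ih] at this
      rw [← this]; congr 1; ring
  -- spectra
  have hspecS : ∀ l, l ∈ pSpec S0.closure → l ∈ spectrum ℂ S := by
    intro l hl
    set g : E →L[ℂ] E × E := (ContinuousLinearMap.id ℂ E).prod S with hg
    have hgr := aux_closure S0 g ?_ ?_ _ hdense ?_
    · rw [aux_pSpec _ g hgr (fun x y h => h)] at hl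
      intro hu
      apply hl
      have hu' := hu.neg
      rw [neg_sub, ContinuousLinearMap.isUnit_iff_bijective] at hu'
      exact hu'
    · have : Set.range g = {p : E × E | p.2 = S p.1} := by
        ext p
        constructor
        · rintro ⟨x, rfl⟩; rfl
        · intro hp; exact ⟨p.1, Prod.ext rfl hp.symm⟩
      rw [this]
      exact isClosed_eq continuous_snd (S.continuous.comp continuous_fst)
    · intro x hx
      have : x = 0 := hx
      simp [this]
    · intro p
      rw [S0.mem_graph_iff, ← hS0dom]
      have hval : ∀ y : S0.domain, S0 y = S y := fun y => hι (by ext n; rw [hS0, hS])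
      constructor
      · rintro ⟨y, h1, h2⟩
        exact ⟨y, y.2, Prod.ext h1 (by rw [← h2, hval]; rfl)⟩
      · rintro ⟨x, hx, rfl⟩
        exact ⟨⟨x, hx⟩, rfl, hval _⟩
  have hspecT : ∀ l, l ∈ pSpec T0.closure → l ≠ 0 ∧ l⁻¹ ∈ spectrum ℂ S := by
    intro l hl
    set g : E →L[ℂ] E × E := S.prod (ContinuousLinearMap.id ℂ E) with hg
    have hgr := aux_closure T0 g ?_ ?_ _ hdense ?_
    · rw [aux_pSpec _ g hgr hSinj] at hl
      have hl0 : l ≠ 0 := by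
        rintro rfl
        apply hl
        simp only [zero_smul, sub_zero]
        exact Function.bijective_id
      refine ⟨hl0, fun hu => hl ?_⟩
      have hu' : IsUnit (l • (algebraMap ℂ (E →L[ℂ] E) l⁻¹ - S)) := by
        obtain ⟨u, hu⟩ := hu
        exact ⟨(Units.mk0 l hl0) • u, by rw [← hu]; rfl⟩
      rw [ContinuousLinearMap.isUnit_iff_bijective] at hu'
      have heq : (fun x => (g x).2 - l • (g x).1) =
          ⇑(l • (algebraMap ℂ (E →L[ℂ] E) l⁻¹ - S)) := by
        ext x
        simp [hg, Algebra.algebraMap_eq_smul_one, smul_sub, smul_smul, hl0]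
      rw [heq]
      exact hu'
    · have : Set.range g = {p : E × E | p.1 = S p.2} := by
        ext p
        constructor
        · rintro ⟨x, rfl⟩; rfl
        · intro hp; exact ⟨p.2, Prod.ext hp.symm rfl⟩
      rw [this]
      exact isClosed_eq continuous_fst (S.continuous.comp continuous_snd)
    · intro x hx
      have : S x = S 0 := by rw [map_zero]; exact hx
      exact hSinj this
    · intro p
      rw [T0.mem_graph_iff]
      have hval : ∀ y : T0.domain, S (T0 y) = y := fun y => hι (by
        ext n; rw [hS, hT0, sub_add_cancel])
      have hT0e : ∀ k (h : e k ∈ T0.domain), T0 ⟨e k, h⟩ = e (k - 1) := by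
        intro k h
        apply hSinj
        rw [hval, hSe, sub_add_cancel]
      have hTspan : ∀ x ∈ Submodule.span ℂ (Set.range e), ∃ y ∈ Submodule.span ℂ (Set.range e),
          S y = x := by
        intro x hx
        induction hx using Submodule.span_induction with
        | mem x hx =>
          obtain ⟨k, rfl⟩ := hx
          exact ⟨e (k - 1), Submodule.subset_span ⟨_, rfl⟩, by rw [hSe, sub_add_cancel]⟩
        | zero => exact ⟨0, Submodule.zero_mem _, map_zero _⟩
        | add a b _ _ ha hb =>
          obtain ⟨a', ha, rfl⟩ := ha
          obtain ⟨b', hb, rfl⟩ := hb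
          exact ⟨a' + b', Submodule.add_mem _ ha hb, map_add _ _ _⟩
        | smul c b _ hb =>
          obtain ⟨b', hb, rfl⟩ := hb
          exact ⟨c • b', Submodule.smul_mem _ _ hb, map_smul _ _ _⟩
      have hSspan : ∀ x ∈ Submodule.span ℂ (Set.range e),
          S x ∈ Submodule.span ℂ (Set.range e) := by
        intro x hx
        induction hx using Submodule.span_induction with
        | mem x hx =>
          obtain ⟨k, rfl⟩ := hx
          rw [hSe]
          exact Submodule.subset_span ⟨_, rfl⟩
        | zero => rw [map_zero]; exact Submodule.zero_mem _
        | add a b _ _ ha hb => rw [map_add]; exact Submodule.add_mem _ ha hb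
        | smul c b _ hb => rw [map_smul]; exact Submodule.smul_mem _ _ hb
      constructor
      · rintro ⟨y, h1, h2⟩
        obtain ⟨x, hx, hxy⟩ := hTspan y (by rw [← hT0dom]; exact y.2)
        have : x = T0 y := hSinj (by rw [hxy, hval])
        exact ⟨x, hx, Prod.ext (by rw [← h1, ← hxy]; rfl) (by rw [← h2, ← this]; rfl)⟩
      · rintro ⟨x, hx, rfl⟩
        exact ⟨⟨S x, by rw [hT0dom]; exact hSspan x hx⟩, rfl, hSinj (by rw [hval]; rfl)⟩
  have hcore := aux_core ι hι e he hdense hcoord Ψ hΨ hΨiso S hS M _ hm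
    {z | ∃ l₁ ∈ spectrum ℂ S, ∃ l₂ ∈ spectrum ℂ S, ‖l₁‖ < ‖z‖ ∧ ‖z‖ < ‖l₂‖} (fun z => Iff.rfl)
  have hsub : {z : ℂ | (pRad T0.closure)⁻¹ < (‖z‖₊ : ℝ≥0∞) ∧ (‖z‖₊ : ℝ≥0∞) < pRad S0.closure} ⊆
      {z | ∃ l₁ ∈ spectrum ℂ S, ∃ l₂ ∈ spectrum ℂ S, ‖l₁‖ < ‖z‖ ∧ ‖z‖ < ‖l₂‖} := by
    rintro z ⟨h1, h2⟩
    rw [ENNReal.inv_lt_iff_inv_lt] at h1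
    simp only [pRad, lt_iSup_iff] at h1 h2
    obtain ⟨t, ht, ht'⟩ := h1
    obtain ⟨l₂, hl₂, hl₂'⟩ := h2
    obtain ⟨ht0, hts⟩ := hspecT t ht
    refine ⟨t⁻¹, hts, l₂, hspecS l₂ hl₂, ?_, by exact_mod_cast hl₂'⟩
    rw [ENNReal.inv_lt_iff_inv_lt] at ht'
    have htn : ‖t‖₊ ≠ 0 := by simpa using ht0
    rw [← ENNReal.coe_inv htn, ENNReal.coe_lt_coe] at ht'
    rw [norm_inv]
    exact_mod_cast ht'
  refine ⟨_, fun z hz => hcore.1 z (hsub hz), hcore.2.1.mono hsub, fun z hz => hcore.2.2 z (hsub hz)⟩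

/-- If `ρ(S) > 1/ρ(S⁻¹)`, then for every multiplier `M` the Laurent series
`M̃(z) = Σ_{n∈ℤ} M̂(n) zⁿ` converges on the open annulus
`A = { 1/ρ(S⁻¹) < |z| < ρ(S) }`, and `M̃` is holomorphic on `A` with `|M̃| ≤ ‖M‖`. -/
theorem stmt3
    {E : Type*} [NormedAddCommGroup E] [NormedSpace ℂ E] [CompleteSpace E]
    (ι : E →ₗ[ℂ] (ℤ → ℂ)) (hι : Function.Injective ι)
    (e : ℤ → E) (he : ∀ k : ℤ, ι (e k) = Pi.single k 1)
    (hdense : Dense (Submodule.span ℂ (Set.range e) : Set E))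
    (hcoord : ∀ n : ℤ, Continuous fun x : E => ι x n)
    -- (H3), strengthened so that each `ψ_z` is an isometry of `E`:
    (Ψ : ℂ → E → E)
    (hΨ : ∀ z : ℂ, ‖z‖ = 1 → ∀ x : E, ∀ n : ℤ, ι (Ψ z x) n = ι x n * z ^ n)
    (hΨiso : ∀ z : ℂ, ‖z‖ = 1 → ∀ x : E, ‖Ψ z x‖ = ‖x‖)
    -- `S0` and `T0` are the restrictions of `S` and `S⁻¹` to `F(ℤ)`:
    (S0 T0 : E →ₗ.[ℂ] E)
    (hS0dom : S0.domain = Submodule.span ℂ (Set.range e))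
    (hS0 : ∀ x : S0.domain, ∀ n : ℤ, ι (S0 x) n = ι (x : E) (n - 1))
    (hT0dom : T0.domain = Submodule.span ℂ (Set.range e))
    (hT0 : ∀ x : T0.domain, ∀ n : ℤ, ι (T0 x) n = ι (x : E) (n + 1))
    -- at least one of `S`, `S⁻¹` is bounded:
    (hb : (∀ x : E, ∃ y : E, ∀ n : ℤ, ι y n = ι x (n - 1)) ∨
      (∀ x : E, ∃ y : E, ∀ n : ℤ, ι y n = ι x (n + 1)))
    -- `ρ(S) > 1/ρ(S⁻¹)`:
    (hρ : (pRad T0.closure)⁻¹ < pRad S0.closure)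
    -- `M` is a multiplier on `E`:
    (M : E →L[ℂ] E)
    (hM : ∀ k n : ℤ, ι (M (e (k + 1))) n = ι (M (e k)) (n - 1)) :
    ∃ f : ℂ → ℂ,
      (∀ z ∈ {z : ℂ | (pRad T0.closure)⁻¹ < (‖z‖₊ : ℝ≥0∞) ∧ (‖z‖₊ : ℝ≥0∞) < pRad S0.closure},
        HasSum (fun n : ℤ => ι (M (e 0)) n * z ^ n) (f z)) ∧
      DifferentiableOn ℂ f
        {z : ℂ | (pRad T0.closure)⁻¹ < (‖z‖₊ : ℝ≥0∞) ∧ (‖z‖₊ : ℝ≥0∞) < pRad S0.closure} ∧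
      ∀ z ∈ {z : ℂ | (pRad T0.closure)⁻¹ < (‖z‖₊ : ℝ≥0∞) ∧ (‖z‖₊ : ℝ≥0∞) < pRad S0.closure},
        ‖f z‖ ≤ ‖M‖ := by
  rcases hb with hb | hb
  · exact aux_bounded ι hι e he hdense hcoord Ψ hΨ hΨiso S0 T0 hS0dom hS0 hT0dom hT0 hb M hM
  · -- reflect the index set
    let ι' : E →ₗ[ℂ] (ℤ → ℂ) := (LinearMap.funLeft ℂ ℂ (fun n : ℤ => -n)).comp ι
    have hι' : ∀ x n, ι' x n = ι x (-n) := fun x n => rfl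
    have hrange : Set.range (fun k : ℤ => e (-k)) = Set.range e :=
      (neg_surjective (G := ℤ)).range_comp e
    obtain ⟨f, h1, h2, h3⟩ := aux_bounded ι'
      (fun x y h => hι (by
        ext n
        have := congrFun h (-n)
        rwa [hι', hι', neg_neg] at this))
      (fun k => e (-k))
      (fun k => by
        ext n
        rw [hι', he]
        simp only [Pi.single_apply, neg_inj])
      (by rw [hrange]; exact hdense)
      (fun n => hcoord (-n)) (fun z => Ψ z⁻¹)
      (fun z hz x n => by
        rw [hι', hι', hΨ _ (by simp [hz]), inv_zpow', neg_neg])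
      (fun z hz x => hΨiso _ (by simp [hz]) x)
      T0 S0 (by rw [hrange]; exact hT0dom)
      (fun x n => by rw [hι', hι', hT0]; congr 1; ring)
      (by rw [hrange]; exact hS0dom)
      (fun x n => by rw [hι', hι', hS0]; congr 1; ring)
      (fun x => by
        obtain ⟨y, hy⟩ := hb x
        exact ⟨y, fun n => by rw [hι', hι', hy]; congr 1; ring⟩)
      M
      (fun k n => by
        have := hM (-(k + 1)) (-n + 1)
        rw [add_sub_cancel_right, show -(k + 1) + 1 = -k by ring] at this
        rw [hι', hι', ← this, show -(n - 1) = -n + 1 by ring])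
    have hmaps : ∀ z ∈ {z : ℂ | (pRad T0.closure)⁻¹ < (‖z‖₊ : ℝ≥0∞) ∧
        (‖z‖₊ : ℝ≥0∞) < pRad S0.closure}, z ≠ 0 ∧
        z⁻¹ ∈ {z : ℂ | (pRad S0.closure)⁻¹ < (‖z‖₊ : ℝ≥0∞) ∧
          (‖z‖₊ : ℝ≥0∞) < pRad T0.closure} := by
      rintro z ⟨ha, hb⟩
      have hz0 : z ≠ 0 := by
        rintro rfl
        simp at ha
      have hzn : ‖z‖₊ ≠ 0 := by simpa using hz0
      refine ⟨hz0, ?_, ?_⟩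
      · rw [nnnorm_inv, ENNReal.coe_inv hzn, ENNReal.inv_lt_inv]
        exact hb
      · rw [nnnorm_inv, ENNReal.coe_inv hzn, ENNReal.inv_lt_iff_inv_lt]
        exact ha
    refine ⟨fun z => f z⁻¹, fun z hz => ?_, ?_, fun z hz => h3 _ (hmaps z hz).2⟩
    · have := h1 _ (hmaps z hz).2
      rw [← (Equiv.neg ℤ).hasSum_iff] at this
      convert this using 1
      ext n
      simp only [Function.comp_apply, Equiv.neg_apply, hι', neg_neg, neg_zero, inv_zpow']
    · exact h2.comp (fun z hz => (differentiableAt_inv (hmaps z hz).1).differentiableWithinAt)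
        (fun z hz => (hmaps z hz).2)
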